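/- arXiv:1306.1444 — 5 statements merged into one kernel-verified Lean document; each statement's English description precedes it below -/
import Mathlib

section
/- Let n ≥ 1 and let F = FreeGroup (Fin n) act on a set X (a Schreier graph of F_n, with y a neighbor of x when y = s • x or y = s⁻¹ • x for a standard generator s). Then there exists a constant C ≥ 1 such that the family {τ_r}_{r∈ℕ} is uniformly C-Lipschitz over X: for every r ∈ ℕ, every x ∈ X, and every standard generator s of F (or its inverse), τ_r(x) ≤ C · τ_r(s • x). -/
open scoped BigOperators

/-- The `r`-neighborhood of a point `x` in a Schreier graph of the free group `F_n`,
modeled as the set of points reachable from `x` by a group element of norm at most `r`. -/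
def nbhd (n : ℕ) {X : Type*} [MulAction (FreeGroup (Fin n)) X] (r : ℕ) (x : X) : Set X :=
  {y | ∃ g : FreeGroup (Fin n), FreeGroup.norm g ≤ r ∧ g • x = y}

/-- The relative thinness function `τ_r(x) = Σ_{y ∈ U_r(x)} 1/|U_r(y)|`. -/
noncomputable def tau (n : ℕ) {X : Type*} [MulAction (FreeGroup (Fin n)) X]
    (r : ℕ) (x : X) : ℝ :=
  ∑ᶠ y ∈ nbhd n r x, (1 : ℝ) / ((nbhd n r y).ncard : ℝ)

/-- The unit ball of the free group, as a finset. -/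
def unitBall (n : ℕ) : Finset (FreeGroup (Fin n)) :=
  insert 1 (Finset.univ.image fun p : Fin n × Bool => FreeGroup.mk [p])

theorem mem_unitBall {n : ℕ} {g : FreeGroup (Fin n)} :
    g ∈ unitBall n ↔ FreeGroup.norm g ≤ 1 := by
  constructor
  · intro h
    simp only [unitBall, Finset.mem_insert, Finset.mem_image, Finset.mem_univ, true_and] at h
    rcases h with rfl | ⟨p, rfl⟩
    · simp
    · exact FreeGroup.norm_mk_le
  · intro h
    rw [FreeGroup.norm] at h
    rw [← FreeGroup.mk_toWord (x := g)]
    generalize g.toWord = L at h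
    match L, h with
    | [], _ => simp [unitBall, FreeGroup.one_eq_mk]
    | [p], _ => simp [unitBall]

theorem exists_unitBall_mul {n r : ℕ} {g : FreeGroup (Fin n)} (hg : FreeGroup.norm g ≤ r + 1) :
    ∃ s ∈ unitBall n, ∃ h, FreeGroup.norm h ≤ r ∧ g = s * h := by
  rw [FreeGroup.norm] at hg
  rw [← FreeGroup.mk_toWord (x := g)]
  generalize g.toWord = L at hg
  match L, hg with
  | [], _ => exact ⟨1, by simp [unitBall], 1, by simp, by simp [FreeGroup.one_eq_mk]⟩
  | p :: L, hg =>
    refine ⟨FreeGroup.mk [p], by simp [unitBall], FreeGroup.mk L,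
      FreeGroup.norm_mk_le.trans (by simpa using hg), by simp [FreeGroup.mul_mk]⟩

theorem one_le_card_unitBall (n : ℕ) : 1 ≤ (unitBall n).card :=
  Finset.card_pos.2 ⟨1, by simp [unitBall]⟩

section

variable {n : ℕ} {X : Type*} [MulAction (FreeGroup (Fin n)) X]

theorem mem_nbhd_self (r : ℕ) (x : X) : x ∈ nbhd n r x :=
  ⟨1, by simp, one_smul _ x⟩

theorem nbhd_finite (r : ℕ) (x : X) : (nbhd n r x).Finite := by
  induction r with
  | zero =>
    refine (Set.finite_singleton x).subset ?_
    rintro _ ⟨g, hg, rfl⟩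
    simp [FreeGroup.norm_eq_zero.1 (Nat.le_zero.1 hg)]
  | succ r ih =>
    refine (Set.Finite.image2 (fun (s : FreeGroup (Fin n)) (y : X) => s • y)
      (unitBall n).finite_toSet ih).subset ?_
    rintro _ ⟨g, hg, rfl⟩
    obtain ⟨s, hs, h, hh, rfl⟩ := exists_unitBall_mul hg
    exact ⟨s, hs, h • x, ⟨h, hh, rfl⟩, (mul_smul s h x).symm⟩

theorem ncard_nbhd_pos (r : ℕ) (x : X) : 0 < (nbhd n r x).ncard :=
  (Set.ncard_pos (nbhd_finite r x)).2 ⟨x, mem_nbhd_self r x⟩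

theorem ncard_nbhd_smul_le {r : ℕ} {b : FreeGroup (Fin n)} (hb : b ∈ unitBall n) (y : X) :
    (nbhd n r (b • y)).ncard ≤ (unitBall n).card * (nbhd n r y).ncard := by
  classical
  have hsub : nbhd n r (b • y) ⊆ ↑(Finset.image₂ (fun (s : FreeGroup (Fin n)) (z : X) => s • z)
      (unitBall n) (nbhd_finite (n := n) r y).toFinset) := by
    rintro _ ⟨g, hg, rfl⟩
    obtain ⟨s, hs, h, hh, e⟩ := exists_unitBall_mul
      ((FreeGroup.norm_mul_le g b).trans (add_le_add hg (mem_unitBall.1 hb)))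
    rw [← mul_smul, e, mul_smul]
    exact Finset.mem_image₂_of_mem hs ((Set.Finite.mem_toFinset _).2 ⟨h, hh, rfl⟩)
  calc (nbhd n r (b • y)).ncard
      ≤ _ := Set.ncard_le_ncard hsub (Finset.finite_toSet _)
    _ ≤ _ := by
      rw [Set.ncard_coe_finset, Set.ncard_eq_toFinset_card _ (nbhd_finite r y)]
      exact Finset.card_image₂_le _ _ _

theorem exists_unitBall_smul_mem_nbhd {r : ℕ} {t : FreeGroup (Fin n)} (ht : t ∈ unitBall n)
    {x y : X} (hy : y ∈ nbhd n r x) : ∃ b ∈ unitBall n, b • y ∈ nbhd n r (t • x) := by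
  obtain ⟨g, hg, rfl⟩ := hy
  cases r with
  | zero =>
    rw [FreeGroup.norm_eq_zero.1 (Nat.le_zero.1 hg), one_smul]
    exact ⟨t, ht, mem_nbhd_self 0 _⟩
  | succ r =>
    obtain ⟨s, hs, h, hh, rfl⟩ := exists_unitBall_mul hg
    rw [mem_unitBall] at hs ht
    refine ⟨s⁻¹, mem_unitBall.2 (by rwa [FreeGroup.norm_inv_eq]), h * t⁻¹, ?_, ?_⟩
    · exact (FreeGroup.norm_mul_le _ _).trans
        (add_le_add hh (by rwa [FreeGroup.norm_inv_eq]))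
    · simp [mul_smul]

theorem tau_eq_sum (r : ℕ) (x : X) :
    tau n r x = ∑ y ∈ (nbhd_finite (n := n) r x).toFinset, (1 : ℝ) / (nbhd n r y).ncard :=
  finsum_mem_eq_finite_toFinset_sum _ _

theorem tau_le_mul_tau_smul (r : ℕ) (x : X) {t : FreeGroup (Fin n)} (ht : t ∈ unitBall n) :
    tau n r x ≤ ((unitBall n).card : ℝ) ^ 2 * tau n r (t • x) := by
  classical
  rw [tau_eq_sum, tau_eq_sum]
  set A := (nbhd_finite (n := n) r x).toFinset
  set B := (nbhd_finite (n := n) r (t • x)).toFinset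
  set K : ℝ := ((unitBall n).card : ℝ)
  let f : X → ℝ := fun y => 1 / (nbhd n r y).ncard
  have hf : ∀ y, 0 ≤ f y := fun y => by positivity
  have hpoint : ∀ y ∈ A, f y ≤ ∑ b ∈ unitBall n, if b • y ∈ B then K * f (b • y) else 0 := by
    intro y hy
    obtain ⟨b, hb, hby⟩ := exists_unitBall_smul_mem_nbhd ht ((Set.Finite.mem_toFinset _).1 hy)
    have hfb : f y ≤ K * f (b • y) := by
      have h1 : (0 : ℝ) < (nbhd n r y).ncard := by exact_mod_cast ncard_nbhd_pos r y
      have h2 : (0 : ℝ) < (nbhd n r (b • y)).ncard := by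
        exact_mod_cast ncard_nbhd_pos r (b • y)
      have h3 : ((nbhd n r (b • y)).ncard : ℝ) ≤ K * (nbhd n r y).ncard := by
        rw [← Nat.cast_mul]
        exact Nat.cast_le.2 (ncard_nbhd_smul_le hb y)
      simp only [f]
      rw [mul_one_div, div_le_div_iff₀ h1 h2]
      simpa using h3
    calc f y ≤ if b • y ∈ B then K * f (b • y) else 0 := by
          rwa [if_pos ((Set.Finite.mem_toFinset _).2 hby)]
      _ ≤ _ := Finset.single_le_sum
          (f := fun b : FreeGroup (Fin n) => if b • y ∈ B then K * f (b • y) else 0)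
          (fun b _ => by
            split_ifs
            · exact mul_nonneg (Nat.cast_nonneg _) (hf _)
            · exact le_rfl) hb
  have htranslate : ∀ b : FreeGroup (Fin n),
      (∑ y ∈ A, if b • y ∈ B then K * f (b • y) else 0) ≤ K * ∑ z ∈ B, f z := by
    intro b
    rw [← Finset.sum_filter, Finset.mul_sum,
      ← Finset.sum_image (f := fun z => K * f z) (g := fun y : X => b • y)
        ((MulAction.injective b).injOn)]
    refine Finset.sum_le_sum_of_subset_of_nonneg ?_
      fun z _ _ => mul_nonneg (Nat.cast_nonneg _) (hf z)
    intro z hz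
    obtain ⟨y, hy, rfl⟩ := Finset.mem_image.1 hz
    exact (Finset.mem_filter.1 hy).2
  calc ∑ y ∈ A, f y
      ≤ ∑ y ∈ A, ∑ b ∈ unitBall n, if b • y ∈ B then K * f (b • y) else 0 :=
        Finset.sum_le_sum hpoint
    _ = ∑ b ∈ unitBall n, ∑ y ∈ A, if b • y ∈ B then K * f (b • y) else 0 := Finset.sum_comm
    _ ≤ ∑ _b ∈ unitBall n, K * ∑ z ∈ B, f z := Finset.sum_le_sum fun b _ => htranslate b
    _ = K ^ 2 * ∑ z ∈ B, f z := by rw [Finset.sum_const, nsmul_eq_mul]; ring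

end

/-- On any Schreier graph of `F_n` there is a constant `C ≥ 1` such that the family
`{τ_r}` is uniformly `C`-Lipschitz: `τ_r(x) ≤ C·τ_r(s • x)` for every standard
generator `s` of `F_n` or its inverse. -/
theorem tau_uniformly_lipschitz (n : ℕ) (hn : 1 ≤ n) (X : Type*)
    [MulAction (FreeGroup (Fin n)) X] :
    ∃ C : ℝ, 1 ≤ C ∧ ∀ (r : ℕ) (x : X) (i : Fin n),
      tau n r x ≤ C * tau n r (FreeGroup.of i • x) ∧
      tau n r x ≤ C * tau n r ((FreeGroup.of i)⁻¹ • x) := by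
  refine ⟨((unitBall n).card : ℝ) ^ 2,
    one_le_pow₀ (by exact_mod_cast one_le_card_unitBall n), fun r x i => ⟨?_, ?_⟩⟩
  · exact tau_le_mul_tau_smul r x (mem_unitBall.2 (by simp))
  · exact tau_le_mul_tau_smul r x (mem_unitBall.2 (by simp))
end

section
/- For N ≥ 1 let Γ_N be the complete bipartite graph with parts X_N of cardinality 2^N and Y_N of cardinality N. Then: (i) for every vertex x ∈ X_N, τ₁(x) = 1/(N+1) + N/(2^N+1); (ii) the average E(τ₁ | X_N) = 1/(N+1) + N/(2^N+1) tends to 0 as N → ∞; and (iii) the uniform measure of X_N in Γ_N, namely 2^N/(2^N + N), tends to 1 as N → ∞. -/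
open scoped BigOperators
open Filter

/-- `τ₁(v) = Σ_{w ∈ U₁(v)} 1/|U₁(w)|`, where `U₁(v)` is the closed neighborhood of `v`. -/
noncomputable def tau1 {V : Type*} (G : SimpleGraph V) (v : V) : ℝ :=
  ∑ᶠ w ∈ insert v (G.neighborSet v), (1 : ℝ) / ((insert w (G.neighborSet w)).ncard : ℝ)

theorem ncard_closedNeighborSet_inl {X Y : Type*} [Finite Y] (x : X) :
    (insert (Sum.inl x) ((completeBipartiteGraph X Y).neighborSet (Sum.inl x))).ncard
      = Nat.card Y + 1 := by
  have h : (completeBipartiteGraph X Y).neighborSet (Sum.inl x) = Set.range Sum.inr := by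
    ext (v | v) <;> simp
  rw [h, Set.ncard_insert_of_notMem (by simp) (Set.finite_range _),
    ← Set.image_univ, Set.ncard_image_of_injective _ Sum.inr_injective, Set.ncard_univ]

theorem ncard_closedNeighborSet_inr {X Y : Type*} [Finite X] (y : Y) :
    (insert (Sum.inr y) ((completeBipartiteGraph X Y).neighborSet (Sum.inr y))).ncard
      = Nat.card X + 1 := by
  have h : (completeBipartiteGraph X Y).neighborSet (Sum.inr y) = Set.range Sum.inl := by
    ext (v | v) <;> simp
  rw [h, Set.ncard_insert_of_notMem (by simp) (Set.finite_range _),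
    ← Set.image_univ, Set.ncard_image_of_injective _ Sum.inl_injective, Set.ncard_univ]

theorem tau1_completeBipartiteGraph_inl {X Y : Type*} [Finite X] [Finite Y] (x : X) :
    tau1 (completeBipartiteGraph X Y) (Sum.inl x)
      = 1 / ((Nat.card Y : ℝ) + 1) + (Nat.card Y : ℝ) / ((Nat.card X : ℝ) + 1) := by
  have := Fintype.ofFinite Y
  have h : (completeBipartiteGraph X Y).neighborSet (Sum.inl x) = Set.range Sum.inr := by
    ext (v | v) <;> simp
  unfold tau1
  rw [finsum_mem_insert _ (by simp) (Set.toFinite _), ncard_closedNeighborSet_inl, h,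
    finsum_mem_range Sum.inr_injective]
  simp only [ncard_closedNeighborSet_inr]
  rw [finsum_eq_sum_of_fintype]
  simp [div_eq_mul_inv]

theorem tendsto_natCast_div_two_pow :
    Tendsto (fun N : ℕ => (N : ℝ) / (2 : ℝ) ^ N) atTop (nhds 0) := by
  simpa using tendsto_pow_const_div_const_pow_of_one_lt 1 (one_lt_two : (1 : ℝ) < 2)

/-- In the complete bipartite graph `K_{2^N, N}` with parts `X_N` (of size `2^N`) and
`Y_N` (of size `N`): (i) every `x ∈ X_N` has `τ₁(x) = 1/(N+1) + N/(2^N+1)`;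
(ii) the average `E(τ₁ | X_N)` equals this quantity and tends to `0` as `N → ∞`;
(iii) the uniform measure `2^N/(2^N+N)` of `X_N` tends to `1`. -/
theorem bipartite_thinness :
    (∀ N : ℕ, 1 ≤ N → ∀ x : Fin (2 ^ N),
      tau1 (completeBipartiteGraph (Fin (2 ^ N)) (Fin N)) (Sum.inl x)
        = 1 / ((N : ℝ) + 1) + (N : ℝ) / ((2 : ℝ) ^ N + 1)) ∧
    (∀ N : ℕ, 1 ≤ N →
      (1 / ((2 : ℝ) ^ N)) *
          ∑ x : Fin (2 ^ N),
            tau1 (completeBipartiteGraph (Fin (2 ^ N)) (Fin N)) (Sum.inl x)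
        = 1 / ((N : ℝ) + 1) + (N : ℝ) / ((2 : ℝ) ^ N + 1)) ∧
    Tendsto (fun N : ℕ => 1 / ((N : ℝ) + 1) + (N : ℝ) / ((2 : ℝ) ^ N + 1))
      atTop (nhds 0) ∧
    Tendsto (fun N : ℕ => ((2 : ℝ) ^ N) / ((2 : ℝ) ^ N + (N : ℝ)))
      atTop (nhds 1) := by
  have tau (N : ℕ) (x : Fin (2 ^ N)) :
      tau1 (completeBipartiteGraph (Fin (2 ^ N)) (Fin N)) (Sum.inl x)
        = 1 / ((N : ℝ) + 1) + (N : ℝ) / ((2 : ℝ) ^ N + 1) := by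
    simpa using tau1_completeBipartiteGraph_inl (Y := Fin N) x
  refine ⟨fun N _ x => tau N x, fun N _ => ?_, ?_, ?_⟩
  · simp only [tau, Finset.sum_const, Finset.card_univ, Fintype.card_fin, nsmul_eq_mul]
    push_cast
    rw [← mul_assoc, one_div_mul_cancel (by positivity), one_mul]
  · have h : Tendsto (fun N : ℕ => (N : ℝ) / ((2 : ℝ) ^ N + 1)) atTop (nhds 0) := by
      refine squeeze_zero (fun N => by positivity) (fun N => ?_) tendsto_natCast_div_two_pow
      gcongr
      linarith
    simpa using (tendsto_one_div_add_atTop_nhds_zero_nat (𝕜 := ℝ)).add h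
  · have h := (tendsto_natCast_div_two_pow.const_add 1).inv₀ (by norm_num)
    rw [add_zero, inv_one] at h
    refine h.congr fun N => ?_
    have : (0 : ℝ) < 2 ^ N + N := by positivity
    field_simp
end

section
/- For N ≥ 1 let Γ_N be the complete bipartite graph with parts X_N of cardinality 2^N and Y_N of cardinality N. Then for x ∈ X_N and y ∈ Y_N one has τ₁(y) = 1/(2^N+1) + 2^N/(N+1), and the ratio τ₁(y)/τ₁(x) tends to infinity as N → ∞: for every constant C ≥ 1 there exists N₀ such that for all N ≥ N₀, all x ∈ X_N and all y ∈ Y_N, τ₁(y) > C · τ₁(x). In particular, no single constant C can make the functions τ₁ on the graphs Γ_N uniformly C-Lipschitz (where f is C-Lipschitz if f(u) ≤ C·f(v) for all adjacent u, v). -/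
open scoped BigOperators

lemma neighborSet_completeBipartiteGraph_inl {α β : Type*} (a : α) :
    (completeBipartiteGraph α β).neighborSet (Sum.inl a) = Set.range Sum.inr := by
  ext w
  cases w <;> simp

lemma neighborSet_completeBipartiteGraph_inr {α β : Type*} (b : β) :
    (completeBipartiteGraph α β).neighborSet (Sum.inr b) = Set.range Sum.inl := by
  ext w
  cases w <;> simp

lemma ncard_closedNeighborSet_completeBipartiteGraph_inl {α β : Type*} [Fintype β] (a : α) :
    (insert (Sum.inl a)
      ((completeBipartiteGraph α β).neighborSet (Sum.inl a))).ncard = Fintype.card β + 1 := by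
  rw [neighborSet_completeBipartiteGraph_inl,
    Set.ncard_insert_of_notMem (by simp) (Set.finite_range _), ← Set.image_univ,
    Set.ncard_image_of_injective _ Sum.inr_injective, Set.ncard_univ, Nat.card_eq_fintype_card]

lemma ncard_closedNeighborSet_completeBipartiteGraph_inr {α β : Type*} [Fintype α] (b : β) :
    (insert (Sum.inr b)
      ((completeBipartiteGraph α β).neighborSet (Sum.inr b))).ncard = Fintype.card α + 1 := by
  rw [neighborSet_completeBipartiteGraph_inr,
    Set.ncard_insert_of_notMem (by simp) (Set.finite_range _), ← Set.image_univ,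
    Set.ncard_image_of_injective _ Sum.inl_injective, Set.ncard_univ, Nat.card_eq_fintype_card]

lemma tau1_completeBipartiteGraph_inl_s6 {α β : Type*} [Fintype α] [Fintype β] (a : α) :
    tau1 (completeBipartiteGraph α β) (Sum.inl a) =
      1 / ((Fintype.card β : ℝ) + 1) + (Fintype.card β : ℝ) / ((Fintype.card α : ℝ) + 1) := by
  rw [tau1, neighborSet_completeBipartiteGraph_inl,
    finsum_mem_insert _ (by simp) (Set.finite_range _), finsum_mem_range Sum.inr_injective,
    finsum_eq_sum_of_fintype]
  simp only [ncard_closedNeighborSet_completeBipartiteGraph_inl,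
    ncard_closedNeighborSet_completeBipartiteGraph_inr, Finset.sum_const, Finset.card_univ,
    nsmul_eq_mul, Nat.cast_add, Nat.cast_one, mul_one_div]

lemma tau1_completeBipartiteGraph_inr {α β : Type*} [Fintype α] [Fintype β] (b : β) :
    tau1 (completeBipartiteGraph α β) (Sum.inr b) =
      1 / ((Fintype.card α : ℝ) + 1) + (Fintype.card α : ℝ) / ((Fintype.card β : ℝ) + 1) := by
  rw [tau1, neighborSet_completeBipartiteGraph_inr,
    finsum_mem_insert _ (by simp) (Set.finite_range _), finsum_mem_range Sum.inl_injective,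
    finsum_eq_sum_of_fintype]
  simp only [ncard_closedNeighborSet_completeBipartiteGraph_inl,
    ncard_closedNeighborSet_completeBipartiteGraph_inr, Finset.sum_const, Finset.card_univ,
    nsmul_eq_mul, Nat.cast_add, Nat.cast_one, mul_one_div]

/-- In the complete bipartite graph `K_{2^N, N}` with parts `X_N` (of size `2^N`) and
`Y_N` (of size `N`): every `y ∈ Y_N` has `τ₁(y) = 1/(2^N+1) + 2^N/(N+1)`, and the
ratio `τ₁(y)/τ₁(x)` for `x ∈ X_N` tends to infinity — for every `C ≥ 1` there is `N₀`
with `τ₁(y) > C·τ₁(x)` for all `N ≥ N₀`, `x ∈ X_N`, `y ∈ Y_N`. Hence no single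
constant makes the `τ₁` uniformly `C`-Lipschitz over this family of graphs. -/
theorem bipartite_tau_not_uniformly_lipschitz :
    (∀ N : ℕ, 1 ≤ N → ∀ y : Fin N,
      tau1 (completeBipartiteGraph (Fin (2 ^ N)) (Fin N)) (Sum.inr y)
        = 1 / ((2 : ℝ) ^ N + 1) + (2 : ℝ) ^ N / ((N : ℝ) + 1)) ∧
    (∀ C : ℝ, 1 ≤ C → ∃ N₀ : ℕ, ∀ N : ℕ, N₀ ≤ N →
      ∀ (x : Fin (2 ^ N)) (y : Fin N),
        C * tau1 (completeBipartiteGraph (Fin (2 ^ N)) (Fin N)) (Sum.inl x)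
          < tau1 (completeBipartiteGraph (Fin (2 ^ N)) (Fin N)) (Sum.inr y)) := by
  refine ⟨fun N _ y => by simp [tau1_completeBipartiteGraph_inr], fun C hC => ?_⟩
  have hlim := tendsto_pow_const_div_const_pow_of_one_lt 1 (one_lt_two (α := ℝ))
  obtain ⟨N₀, hN₀⟩ := Filter.eventually_atTop.1
    (hlim.eventually_lt_const (show (0 : ℝ) < 1 / (4 * C) by positivity))
  refine ⟨N₀, fun N hN x y => ?_⟩
  have hN1 : (1 : ℝ) ≤ N := by exact_mod_cast y.pos
  have hgrowth := hN₀ N hN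
  rw [pow_one, div_lt_div_iff₀ (by positivity) (by positivity)] at hgrowth
  have hlt : (N : ℝ) < 2 ^ N := by exact_mod_cast N.lt_two_pow_self
  have hx : tau1 (completeBipartiteGraph (Fin (2 ^ N)) (Fin N)) (Sum.inl x) ≤ 2 := by
    rw [tau1_completeBipartiteGraph_inl_s6]
    simp only [Fintype.card_fin, Nat.cast_pow, Nat.cast_ofNat]
    have h₁ : 1 / ((N : ℝ) + 1) ≤ 1 := by
      rw [div_le_one (by positivity)]
      linarith
    have h₂ : (N : ℝ) / ((2 : ℝ) ^ N + 1) ≤ 1 := by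
      rw [div_le_one (by positivity)]
      linarith
    linarith
  have hy : 2 * C < tau1 (completeBipartiteGraph (Fin (2 ^ N)) (Fin N)) (Sum.inr y) := by
    rw [tau1_completeBipartiteGraph_inr]
    simp only [Fintype.card_fin, Nat.cast_pow, Nat.cast_ofNat]
    have h₁ : 0 < 1 / ((2 : ℝ) ^ N + 1) := by positivity
    have h₂ : 2 * C < (2 : ℝ) ^ N / ((N : ℝ) + 1) := by
      rw [lt_div_iff₀ (by positivity)]
      nlinarith
    linarith
  nlinarith
end

section
/- Let Γ be a finite simple graph with vertex set V, let A ⊆ V be nonempty, let K ≥ 0 and ε > 0 be real numbers, and write deg_S(x) = |N(x) ∩ S| for the number of neighbors of x lying in S ⊆ V and deg(x) for the total degree of x. If (1/|A|) · Σ_{x∈A} (1 + deg_A(x)) / (1 + deg(x)) < ε, then the subset A_K := {x ∈ A : deg_{V∖A}(x) ≤ K · deg_A(x)} satisfies |A_K| ≤ (K+1) · ε · |A|. -/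
open scoped BigOperators

/-- Counting step in the construction of a lopsided sofic approximation: if the average
of `(1 + deg_A(x))/(1 + deg(x))` over a nonempty set `A` of vertices of a finite simple
graph is less than `ε`, then the set `A_K` of points of `A` whose external degree is at
most `K` times their internal degree satisfies `|A_K| ≤ (K+1)·ε·|A|`. -/
theorem lopsided_counting (V : Type*) [Fintype V] [DecidableEq V]
    (G : SimpleGraph V) [DecidableRel G.Adj]
    (A : Finset V) (hA : A.Nonempty) (K ε : ℝ) (hK : 0 ≤ K) (hε : 0 < ε)
    (havg : (1 / (A.card : ℝ)) *
        ∑ x ∈ A, (1 + ((G.neighborFinset x ∩ A).card : ℝ)) / (1 + (G.degree x : ℝ))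
      < ε) :
    ((A.filter (fun x =>
        ((G.neighborFinset x \ A).card : ℝ) ≤ K * ((G.neighborFinset x ∩ A).card : ℝ))).card : ℝ)
      ≤ (K + 1) * ε * (A.card : ℝ) := by
  have hA' : (0 : ℝ) < A.card := by exact_mod_cast hA.card_pos
  rw [one_div, inv_mul_lt_iff₀ hA'] at havg
  set f : V → ℝ := fun x =>
    (1 + ((G.neighborFinset x ∩ A).card : ℝ)) / (1 + (G.degree x : ℝ)) with hf
  have one_le_of_mem : ∀ x ∈ A.filter (fun x =>
      ((G.neighborFinset x \ A).card : ℝ) ≤ K * ((G.neighborFinset x ∩ A).card : ℝ)),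
      1 ≤ (K + 1) * f x := by
    intro x hx
    have hext := (Finset.mem_filter.mp hx).2
    have hdeg : (G.degree x : ℝ) =
        ((G.neighborFinset x \ A).card : ℝ) + ((G.neighborFinset x ∩ A).card : ℝ) := by
      rw [← G.card_neighborFinset_eq_degree]
      exact_mod_cast (Finset.card_sdiff_add_card_inter _ _).symm
    rw [hf, ← mul_div_assoc, le_div_iff₀ (by positivity), hdeg]
    linarith
  calc _ ≤ ∑ x ∈ A.filter (fun x =>
      ((G.neighborFinset x \ A).card : ℝ) ≤ K * ((G.neighborFinset x ∩ A).card : ℝ)),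
        (K + 1) * f x := by
        simpa using Finset.card_nsmul_le_sum _ _ 1 one_le_of_mem
    _ ≤ ∑ x ∈ A, (K + 1) * f x :=
        Finset.sum_le_sum_of_subset_of_nonneg (Finset.filter_subset _ _)
          fun x _ _ => by positivity
    _ = (K + 1) * ∑ x ∈ A, f x := (Finset.mul_sum ..).symm
    _ ≤ (K + 1) * (A.card * ε) := by gcongr
    _ = (K + 1) * ε * A.card := by ring
end

section
/- Let a and ε be real numbers with 0 < ε < a, and let x : ℕ → ℝ be a sequence with x(m) ≥ 0 for all m and x(m+1) ≤ (a − ε)·x(m) + ε²·x(m−1) for all m ≥ 1. Then x(m)/a^m tends to 0 as m → ∞. -/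
open Filter

/-- A nonnegative-coefficient two-step recurrence inequality is dominated by the geometric
sequence of any supersolution `l` of its characteristic equation. -/
theorem exists_le_mul_pow_of_two_step_le {b c l : ℝ} (hb : 0 ≤ b) (hc : 0 ≤ c) (hl : 0 < l)
    (hchar : b * l + c ≤ l ^ 2) {x : ℕ → ℝ} (hx : ∀ m, 0 ≤ x m)
    (hrec : ∀ m, x (m + 2) ≤ b * x (m + 1) + c * x m) :
    ∃ C : ℝ, ∀ m, x m ≤ C * l ^ m := by
  have hC : 0 ≤ x 0 + x 1 / l := add_nonneg (hx 0) (div_nonneg (hx 1) hl.le)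
  refine ⟨x 0 + x 1 / l, fun m => ?_⟩
  induction m using Nat.twoStepInduction with
  | zero => simpa using div_nonneg (hx 1) hl.le
  | one =>
    have h : (x 0 + x 1 / l) * l ^ 1 = x 0 * l + x 1 := by field_simp
    rw [h]
    exact le_add_of_nonneg_left (mul_nonneg (hx 0) hl.le)
  | more m h₀ h₁ =>
    set C := x 0 + x 1 / l
    calc x (m + 2) ≤ b * x (m + 1) + c * x m := hrec m
      _ ≤ b * (C * l ^ (m + 1)) + c * (C * l ^ m) := by gcongr
      _ = C * l ^ m * (b * l + c) := by ring
      _ ≤ C * l ^ m * l ^ 2 := by gcongr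
      _ = C * l ^ (m + 2) := by ring

/-- Quantitative growth conclusion: if `0 < ε < a` and a nonnegative sequence satisfies
`x(m+1) ≤ (a−ε)·x(m) + ε²·x(m−1)` for all `m ≥ 1`, then `x(m)/a^m → 0`. -/
theorem growth_ratio_tendsto_zero (a ε : ℝ) (hε : 0 < ε) (hεa : ε < a)
    (x : ℕ → ℝ) (hx : ∀ m, 0 ≤ x m)
    (hrec : ∀ m : ℕ, 1 ≤ m → x (m + 1) ≤ (a - ε) * x m + ε ^ 2 * x (m - 1)) :
    Tendsto (fun m : ℕ => x m / a ^ m) atTop (nhds 0) := by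
  have ha : 0 < a := hε.trans hεa
  obtain ⟨l, hl, hla, hchar⟩ : ∃ l : ℝ, 0 < l ∧ l < a ∧ (a - ε) * l + ε ^ 2 ≤ l ^ 2 := by
    refine ⟨(a ^ 2 + ε ^ 2) / (a + ε), by positivity, ?_, ?_⟩
    · rw [div_lt_iff₀ (by positivity)]
      nlinarith
    · have h : ((a ^ 2 + ε ^ 2) / (a + ε)) ^ 2
          - ((a - ε) * ((a ^ 2 + ε ^ 2) / (a + ε)) + ε ^ 2)
          = (ε * (a - ε) / (a + ε)) ^ 2 := by
        field_simp
        ring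
      linarith [sq_nonneg (ε * (a - ε) / (a + ε))]
  obtain ⟨C, hC⟩ := exists_le_mul_pow_of_two_step_le (sub_nonneg.2 hεa.le) (sq_nonneg ε) hl
    hchar hx fun m => hrec (m + 1) (Nat.le_add_left 1 m)
  have hlim : Tendsto (fun m : ℕ => C * (l / a) ^ m) atTop (nhds 0) := by
    simpa using (tendsto_pow_atTop_nhds_zero_of_lt_one (by positivity)
      ((div_lt_one ha).2 hla)).const_mul C
  refine squeeze_zero (fun m => div_nonneg (hx m) (by positivity)) (fun m => ?_) hlim
  rw [div_pow, ← mul_div_assoc]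
  gcongr
  exact hC m
end
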